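/- Let G be a nonempty c-path bounded subset of D, and suppose there exist sets A ⊆ X and B ⊆ Y with G ⊆ A × B ⊆ D. Then G has a c-antiderivative. -/

import Mathlib

open scoped BigOperators

namespace Paper

variable {X Y : Type*}

/-- The domain of the cost `c`, i.e. the set where `c` is finite. -/
def Dom (c : X × Y → EReal) : Set (X × Y) := {p | c p < ⊤}

/-- `z` is a path in `G` from `p` to `q` (with `N` steps). -/
def IsPath (c : X × Y → EReal) (G : Set (X × Y)) (p q : X × Y)
    (N : ℕ) (z : Fin (N + 1) → X × Y) : Prop :=
  (∀ k, z k ∈ G) ∧ z 0 = p ∧ z (Fin.last N) = q ∧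
    ∀ k : Fin N, c ((z k.succ).1, (z k.castSucc).2) < ⊤

/-- The inner variation `∑_{k=1}^N (c(x_k,y_k) − c(x_{k+1},y_k))` along a path; all the
terms involved are finite for a path in `G ⊆ Dom c`, so the real-valued sum is faithful. -/
noncomputable def pathSum (c : X × Y → EReal) {N : ℕ} (z : Fin (N + 1) → X × Y) : ℝ :=
  ∑ k : Fin N, ((c (z k.castSucc)).toReal - (c ((z k.succ).1, (z k.castSucc).2)).toReal)

/-- The maximal inner variation `F_G(p,q)`, with the convention `sSup ∅ = ⊥ = −∞`. -/
noncomputable def innerVar (c : X × Y → EReal) (G : Set (X × Y)) (p q : X × Y) : EReal :=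
  sSup {s : EReal | ∃ (N : ℕ) (z : Fin (N + 1) → X × Y),
    IsPath c G p q N z ∧ s = ((pathSum c z : ℝ) : EReal)}

/-- `G` is `c`-path bounded. -/
def PathBounded (c : X × Y → EReal) (G : Set (X × Y)) : Prop :=
  ∀ p ∈ G, ∀ q ∈ G, innerVar c G p q < ⊤

/-- `G` is `c`-cyclically monotone. -/
def CyclicallyMonotone (c : X × Y → EReal) (G : Set (X × Y)) : Prop :=
  ∀ p ∈ G, innerVar c G p p ≤ 0

/-- `f` is a `c`-antiderivative of `G`:
`c(x,y) − c(u,y) ≤ f(x,y) − f(u,v)` in `[−∞,+∞]` for all `(x,y),(u,v) ∈ G`. -/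
def IsAntideriv (c : X × Y → EReal) (G : Set (X × Y)) (f : X × Y → ℝ) : Prop :=
  ∀ p ∈ G, ∀ q ∈ G, c p - c (q.1, p.2) ≤ (f p : EReal) - (f q : EReal)

/-- `p` and `q` are strongly connected (mutually reachable by paths) in `G`. -/
def StronglyConn (c : X × Y → EReal) (G : Set (X × Y)) (p q : X × Y) : Prop :=
  (∃ N z, IsPath c G p q N z) ∧ (∃ N z, IsPath c G q p N z)

/-- Prepending a point to a path. -/
theorem IsPath.cons {c : X × Y → EReal} {G : Set (X × Y)} {p q r : X × Y} {N : ℕ}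
    {z : Fin (N + 1) → X × Y} (hz : IsPath c G q r N z) (hp : p ∈ G) (hpq : c (q.1, p.2) < ⊤) :
    IsPath c G p r (N + 1) (Fin.cons p z : Fin (N + 2) → X × Y) := by
  obtain ⟨hG, h0, hlast, hfin⟩ := hz
  refine ⟨Fin.cases hp hG, rfl, ?_, Fin.cases ?_ fun k => ?_⟩
  · rwa [← Fin.succ_last, Fin.cons_succ]
  · simpa [h0] using hpq
  · simpa [← Fin.succ_castSucc] using hfin k

theorem pathSum_cons (c : X × Y → EReal) {N : ℕ} (p : X × Y) (z : Fin (N + 1) → X × Y) :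
    pathSum c (Fin.cons p z : Fin (N + 2) → X × Y) =
      ((c p).toReal - (c ((z 0).1, p.2)).toReal) + pathSum c z := by
  simp [pathSum, Fin.sum_univ_succ (n := N)]

theorem IsPath.le_innerVar {c : X × Y → EReal} {G : Set (X × Y)} {p q : X × Y} {N : ℕ}
    {z : Fin (N + 1) → X × Y} (hz : IsPath c G p q N z) :
    (pathSum c z : EReal) ≤ innerVar c G p q :=
  le_sSup ⟨N, z, hz, rfl⟩

/-- if `G ⊆ A × B ⊆ Dom c`, then the `c`-path bounded set `G` has a
`c`-antiderivative. -/
theorem antideriv_of_subset_prod (c : X × Y → EReal) (hbot : ∀ p, c p ≠ ⊥)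
    (G : Set (X × Y)) (hne : G.Nonempty) (hGD : G ⊆ Dom c)
    (hpb : PathBounded c G)
    (A : Set X) (B : Set Y) (hGA : G ⊆ A ×ˢ B) (hAB : A ×ˢ B ⊆ Dom c) :
    ∃ f : X × Y → ℝ, IsAntideriv c G f := by
  have hfin : ∀ p ∈ G, ∀ q ∈ G, c (q.1, p.2) < ⊤ := fun p hp q hq =>
    hAB ⟨(hGA hq).1, (hGA hp).2⟩
  obtain ⟨r, hr⟩ := hne
  have hrr : IsPath c G r r 0 fun _ => r := ⟨fun _ => hr, rfl, rfl, fun k => k.elim0⟩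
  have hcoe : ∀ p ∈ G, ((innerVar c G p r).toReal : EReal) = innerVar c G p r := fun p hp =>
    EReal.coe_toReal (hpb p hp r hr).ne
      (ne_bot_of_le_ne_bot (EReal.coe_ne_bot _) (hrr.cons hp (hfin p hp r hr)).le_innerVar)
  refine ⟨fun p => (innerVar c G p r).toReal, fun p hp q hq => ?_⟩
  have key : (innerVar c G q r).toReal ≤
      (innerVar c G p r).toReal - ((c p).toReal - (c (q.1, p.2)).toReal) := by
    rw [← EReal.coe_le_coe_iff, hcoe q hq]
    refine sSup_le ?_
    rintro _ ⟨N, z, hz, rfl⟩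
    have hle := (hz.cons hp (hfin p hp q hq)).le_innerVar
    rw [← hcoe p hp, EReal.coe_le_coe_iff, pathSum_cons, hz.2.1] at hle
    rw [EReal.coe_le_coe_iff]
    linarith
  rw [← EReal.coe_toReal (hGD hp).ne (hbot p),
    ← EReal.coe_toReal (hfin p hp q hq).ne (hbot _), ← EReal.coe_sub, ← EReal.coe_sub,
    EReal.coe_le_coe_iff]
  linarith

end Paper
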